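/- arXiv:2012.08944 — 2 statements merged into one kernel-verified Lean document; each statement's English description precedes it below -/
import Mathlib

section
/- For all real z and α: J_0(z) + 2·Σ_{k=1}^∞ (-1)^k J_{2k}(z)·cos(2kα) = cos(z·cos α). -/
open scoped Real

/-- Bessel function of the first kind of integer order `m`,
defined by `J_m(z) = (1/2π) ∫_0^{2π} e^{i z sin θ - i m θ} dθ`. -/
noncomputable def besselJ (m : ℤ) (z : ℂ) : ℂ :=
  (1 / (2 * Real.pi)) * ∫ θ in (0:ℝ)..(2 * Real.pi),
    Complex.exp (z * Complex.sin (θ:ℂ) * Complex.I - (m:ℂ) * (θ:ℂ) * Complex.I)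

open Complex

theorem norm_besselJ_le_one (m : ℤ) (z : ℝ) : ‖besselJ m z‖ ≤ 1 := by
  have hbound : ‖∫ θ in (0:ℝ)..(2 * Real.pi),
      exp ((z : ℂ) * sin (θ:ℂ) * I - (m:ℂ) * (θ:ℂ) * I)‖ ≤ 1 * |2 * Real.pi - 0| := by
    refine intervalIntegral.norm_integral_le_of_norm_le_const fun θ _ => ?_
    have harg : (z : ℂ) * sin (θ:ℂ) * I - (m:ℂ) * (θ:ℂ) * I
        = ((z * Real.sin θ - m * θ : ℝ) : ℂ) * I := by
      push_cast; ring
    rw [harg, norm_exp_ofReal_mul_I]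
  have hpi : (0:ℝ) < 2 * Real.pi := Real.two_pi_pos
  rw [sub_zero, abs_of_pos hpi, one_mul] at hbound
  have hnorm : ‖(1 / (2 * Real.pi) : ℂ)‖ = 1 / (2 * Real.pi) := by
    rw [show (1 / (2 * Real.pi) : ℂ) = ((1 / (2 * Real.pi) : ℝ) : ℂ) by push_cast; rfl,
      norm_real, Real.norm_of_nonneg (by positivity)]
  rw [besselJ, norm_mul, hnorm, one_div, inv_mul_le_iff₀ hpi, mul_one]
  exact hbound

theorem besselJ_integrand_periodic (m : ℤ) (z : ℂ) :
    Function.Periodic (fun θ : ℝ => exp (z * sin (θ:ℂ) * I - (m:ℂ) * (θ:ℂ) * I))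
      (2 * Real.pi) := by
  intro θ
  refine exp_eq_exp_iff_exists_int.mpr ⟨-m, ?_⟩
  push_cast
  rw [sin_add_two_pi]
  ring

theorem intervalIntegrable_besselJ_integrand (m : ℤ) (z : ℂ) (a b : ℝ) :
    IntervalIntegrable (fun θ : ℝ => exp (z * sin (θ:ℂ) * I - (m:ℂ) * (θ:ℂ) * I))
      MeasureTheory.volume a b :=
  Continuous.intervalIntegrable (by fun_prop) a b

/-- The three-term recurrence `m J_m(z) = (z / 2) (J_{m-1}(z) + J_{m+1}(z))`. -/
theorem int_mul_besselJ (m : ℤ) (z : ℂ) :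
    (m : ℂ) * besselJ m z = z / 2 * (besselJ (m - 1) z + besselJ (m + 1) z) := by
  have hderiv : ∀ θ : ℝ, HasDerivAt
      (fun θ : ℝ => exp (z * sin (θ:ℂ) * I - (m:ℂ) * (θ:ℂ) * I))
      (exp (z * sin (θ:ℂ) * I - (m:ℂ) * (θ:ℂ) * I) * (z * cos (θ:ℂ) * I - (m:ℂ) * I)) θ := by
    intro θ
    have h := ((((hasDerivAt_sin (θ : ℂ)).const_mul z).mul_const I).sub
      (((hasDerivAt_id (θ : ℂ)).const_mul (m : ℂ)).mul_const I)).cexp.comp_ofReal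
    simpa using h
  have hzero := intervalIntegral.integral_eq_sub_of_hasDerivAt (a := 0) (b := 2 * Real.pi)
    (fun θ _ => hderiv θ) (Continuous.intervalIntegrable (by fun_prop) _ _)
  have hper := besselJ_integrand_periodic m z 0
  simp only [zero_add] at hper
  rw [hper, sub_self] at hzero
  have hsplit : ∀ θ : ℝ,
      exp (z * sin (θ:ℂ) * I - (m:ℂ) * (θ:ℂ) * I) * (z * cos (θ:ℂ) * I - (m:ℂ) * I)
      = z / 2 * I * (exp (z * sin (θ:ℂ) * I - ((m - 1 : ℤ):ℂ) * (θ:ℂ) * I)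
          + exp (z * sin (θ:ℂ) * I - ((m + 1 : ℤ):ℂ) * (θ:ℂ) * I))
        - (m:ℂ) * I * exp (z * sin (θ:ℂ) * I - (m:ℂ) * (θ:ℂ) * I) := by
    intro θ
    have h1 : z * sin (θ:ℂ) * I - ((m - 1 : ℤ):ℂ) * (θ:ℂ) * I
        = (z * sin (θ:ℂ) * I - (m:ℂ) * (θ:ℂ) * I) + θ * I := by push_cast; ring
    have h2 : z * sin (θ:ℂ) * I - ((m + 1 : ℤ):ℂ) * (θ:ℂ) * I
        = (z * sin (θ:ℂ) * I - (m:ℂ) * (θ:ℂ) * I) + -θ * I := by push_cast; ring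
    rw [h1, h2, exp_add, exp_add _ (-θ * I), ← mul_add, ← two_cos]
    ring
  simp_rw [hsplit] at hzero
  have hi := fun m => intervalIntegrable_besselJ_integrand m z 0 (2 * Real.pi)
  rw [intervalIntegral.integral_sub (((hi _).add (hi _)).const_mul _) ((hi _).const_mul _),
    intervalIntegral.integral_const_mul, intervalIntegral.integral_const_mul,
    intervalIntegral.integral_add (hi _) (hi _)] at hzero
  simp only [besselJ]
  refine mul_left_cancel₀ I_ne_zero ?_
  linear_combination (-1 / (2 * Real.pi)) * hzero

theorem besselJ_neg_two_mul (k : ℤ) (z : ℂ) : besselJ (-(2 * k)) z = besselJ (2 * k) z := by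
  have hreflect : ∀ θ : ℝ, exp (z * sin (θ:ℂ) * I - ((-(2 * k) : ℤ):ℂ) * (θ:ℂ) * I)
      = exp (z * sin ((Real.pi - θ : ℝ):ℂ) * I
          - ((2 * k : ℤ):ℂ) * ((Real.pi - θ : ℝ):ℂ) * I) := by
    intro θ
    refine exp_eq_exp_iff_exists_int.mpr ⟨k, ?_⟩
    push_cast
    rw [sin_pi_sub]
    ring
  have hshift := (besselJ_integrand_periodic (2 * k) z).intervalIntegral_add_eq (-Real.pi) 0
  rw [zero_add, show -Real.pi + 2 * Real.pi = Real.pi by ring] at hshift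
  simp only [besselJ]
  rw [← hshift]
  simp_rw [hreflect]
  rw [intervalIntegral.integral_comp_sub_left (fun θ : ℝ => exp (z * sin (θ:ℂ) * I
    - ((2 * k : ℤ):ℂ) * (θ:ℂ) * I))]
  rw [sub_zero, show Real.pi - 2 * Real.pi = -Real.pi by ring]

theorem summable_besselJ (z : ℝ) : Summable fun m : ℤ => besselJ m z := by
  have hlin : ∀ m : ℤ, |(m:ℝ)| * ‖besselJ m z‖ ≤ |z| := by
    intro m
    have h := congrArg norm (int_mul_besselJ m z)
    rw [norm_mul, norm_mul, norm_div, norm_intCast, norm_real, Real.norm_eq_abs, RCLike.norm_ofNat] at h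
    have htri := norm_add_le (besselJ (m - 1) z) (besselJ (m + 1) z)
    have h1 := norm_besselJ_le_one (m - 1) z
    have h2 := norm_besselJ_le_one (m + 1) z
    rw [h]
    nlinarith [abs_nonneg z]
  have hquad : ∀ m : ℤ, (m:ℝ) ^ 2 * ‖besselJ m z‖ ≤ |z| * (|z| + 1) := by
    intro m
    have h := congrArg norm (int_mul_besselJ m z)
    rw [norm_mul, norm_mul, norm_div, norm_intCast, norm_real, Real.norm_eq_abs, RCLike.norm_ofNat] at h
    have hnear : ∀ n : ℤ, |(m:ℝ)| ≤ |(n:ℝ)| + 1 → |(m:ℝ)| * ‖besselJ n z‖ ≤ |z| + 1 := by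
      intro n hn
      nlinarith [hlin n, norm_besselJ_le_one n z, norm_nonneg (besselJ n z)]
    have h1 := hnear (m - 1) (by
      push_cast; linarith [abs_sub_abs_le_abs_sub (m:ℝ) (m - 1), show |(m:ℝ) - (m - 1)| = 1 by simp])
    have h2 := hnear (m + 1) (by
      push_cast; linarith [abs_sub_abs_le_abs_sub (m:ℝ) (m + 1), show |(m:ℝ) - (m + 1)| = 1 by simp])
    have htri := norm_add_le (besselJ (m - 1) z) (besselJ (m + 1) z)
    rw [← sq_abs, sq, mul_assoc, h]
    calc |(m:ℝ)| * (|z| / 2 * ‖besselJ (m - 1) z + besselJ (m + 1) z‖)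
        ≤ |(m:ℝ)| * (|z| / 2 * (‖besselJ (m - 1) z‖ + ‖besselJ (m + 1) z‖)) := by gcongr
      _ = |z| / 2 * (|(m:ℝ)| * ‖besselJ (m - 1) z‖ + |(m:ℝ)| * ‖besselJ (m + 1) z‖) := by ring
      _ ≤ |z| / 2 * ((|z| + 1) + (|z| + 1)) := by gcongr
      _ = |z| * (|z| + 1) := by ring
  refine Summable.of_norm_bounded_eventually
    ((Real.summable_one_div_int_pow.mpr one_lt_two).mul_left (|z| * (|z| + 1))) ?_
  filter_upwards [(Set.finite_singleton (0:ℤ)).compl_mem_cofinite] with m hm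
  have hm0 : (m:ℝ) ≠ 0 := by exact_mod_cast hm
  rw [mul_one_div, le_div_iff₀ (by positivity), mul_comm]
  exact hquad m

/-- The Jacobi–Anger expansion of `e^{i z sin θ}`. -/
theorem hasSum_besselJ_mul_exp (z θ : ℝ) :
    HasSum (fun m : ℤ => besselJ m z * exp (m * θ * I)) (exp (z * Real.sin θ * I)) := by
  have : Fact (0 < 2 * Real.pi) := ⟨Real.two_pi_pos⟩
  let f : C(AddCircle (2 * Real.pi), ℂ) :=
    ⟨fun t => exp (z * (Real.Angle.sin t : ℝ) * I), by
      have : Continuous fun t : AddCircle (2 * Real.pi) => Real.Angle.sin t :=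
        Real.Angle.continuous_sin
      fun_prop⟩
  have hf : ∀ x : ℝ, f (x : AddCircle (2 * Real.pi)) = exp (z * Real.sin x * I) := fun x => rfl
  have hcoeff : ∀ m : ℤ, fourierCoeff f m = besselJ m z := by
    intro m
    rw [fourierCoeff_eq_intervalIntegral f m 0, zero_add, besselJ, real_smul]
    push_cast
    congr 1
    refine intervalIntegral.integral_congr fun x _ => ?_
    simp only [hf, fourier_coe_apply, smul_eq_mul, ← exp_add]
    congr 1
    have : (Real.pi : ℂ) ≠ 0 := ofReal_ne_zero.mpr Real.pi_ne_zero
    push_cast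
    field_simp
    ring
  have hsum := has_pointwise_sum_fourier_series_of_summable (f := f)
    ((summable_besselJ z).congr fun m => (hcoeff m).symm) (θ : AddCircle (2 * Real.pi))
  rw [hf] at hsum
  convert hsum using 2 with m
  rw [hcoeff, fourier_coe_apply, smul_eq_mul]
  congr 2
  have : (Real.pi : ℂ) ≠ 0 := ofReal_ne_zero.mpr Real.pi_ne_zero
  push_cast
  field_simp

theorem hasSum_even_besselJ_mul_cos (z α : ℝ) :
    HasSum (fun k : ℕ => 2 * ((-1 : ℂ) ^ k * besselJ (2 * k) z * cos (2 * k * α)))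
      (cos (z * cos α) + besselJ 0 z) := by
  have hplus := hasSum_besselJ_mul_exp z (α + Real.pi / 2)
  have hminus := hasSum_besselJ_mul_exp z (α - Real.pi / 2)
  rw [Real.sin_add_pi_div_two] at hplus
  rw [Real.sin_sub_pi_div_two] at hminus
  have havg : HasSum (fun m : ℤ => besselJ m z * exp (m * α * I) * cos (m * (Real.pi / 2)))
      (cos (z * cos α)) := by
    have hval : cos (z * cos α)
        = (exp (z * Real.cos α * I) + exp (z * (-Real.cos α : ℝ) * I)) / 2 := by
      rw [cos]
      push_cast
      ring_nf
    rw [hval]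
    refine ((hplus.add hminus).div_const 2).congr_fun fun m => ?_
    have h1 : (m:ℂ) * ((α + Real.pi / 2 : ℝ) : ℂ) * I
        = m * α * I + m * (Real.pi / 2) * I := by push_cast; ring
    have h2 : (m:ℂ) * ((α - Real.pi / 2 : ℝ) : ℂ) * I
        = m * α * I + -(m * (Real.pi / 2)) * I := by push_cast; ring
    rw [h1, h2, exp_add, exp_add, cos]
    ring
  have hnat := havg.nat_add_neg
  have hinj : Function.Injective fun k : ℕ => 2 * k := fun a b h => by simpa using h
  rw [← hinj.hasSum_iff] at hnat
  · convert hnat using 1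
    · ext k
      have hcos : cos (k * Real.pi) = (-1 : ℂ) ^ k := by
        exact_mod_cast congrArg ofReal (Real.cos_nat_mul_pi k)
      have h1 : (((2 * k : ℕ) : ℤ) : ℂ) * (Real.pi / 2) = k * Real.pi := by push_cast; ring
      have h2 : ((-((2 * k : ℕ) : ℤ) : ℤ) : ℂ) * (Real.pi / 2) = -(k * Real.pi) := by
        push_cast; ring
      have hJ : besselJ (-((2 * k : ℕ) : ℤ)) z = besselJ (2 * k) z := by
        simpa using besselJ_neg_two_mul k z
      simp only [Function.comp_apply]
      rw [h1, h2, cos_neg, hcos, hJ, cos]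
      push_cast
      ring_nf
    · simp
  · intro n hn
    obtain ⟨j, rfl⟩ : Odd n := by
      rw [← Nat.not_even_iff_odd, even_iff_two_dvd]
      rintro ⟨j, rfl⟩
      exact hn ⟨j, rfl⟩
    have hcos : cos (((2 * j + 1 : ℕ) : ℂ) * (Real.pi / 2)) = 0 :=
      cos_eq_zero_iff.mpr ⟨j, by push_cast; ring⟩
    rw [Int.cast_neg, neg_mul _ (Real.pi / 2 : ℂ), cos_neg, Int.cast_natCast, hcos]
    ring

theorem statement2 (z α : ℝ) :
    besselJ 0 z + 2 * ∑' k : ℕ,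
        (-1 : ℂ) ^ (k + 1) * besselJ (2 * (k + 1)) z * (Real.cos (2 * (k + 1) * α) : ℂ) =
      (Real.cos (z * Real.cos α) : ℂ) := by
  have hsum := hasSum_even_besselJ_mul_cos z α
  rw [show cos (z * cos α) + besselJ 0 z = (cos (z * cos α) - besselJ 0 z)
      + ∑ k ∈ Finset.range 1, 2 * ((-1 : ℂ) ^ k * besselJ (2 * k) z * cos (2 * k * α)) by
    rw [Finset.sum_range_one]
    simp
    ring] at hsum
  have hshift := (hasSum_nat_add_iff 1).mpr hsum
  rw [← tsum_mul_left]
  push_cast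
  push_cast at hshift
  rw [hshift.tsum_eq]
  ring
end

section
/- For every integer n ≥ 1, integer p, and real x: Σ_{k∈ℤ} J_{kn+p}(x)² = 1/n + (1/n)·Σ_{k=1}^{n-1} cos(2πkp/n)·J_0(2x·sin(πk/n)). -/
open scoped Real

open Complex ComplexConjugate

lemma Function.Periodic.integral_zero_two_pi_comp_add {f : ℝ → ℂ}
    (hf : Function.Periodic f (2 * π)) (a : ℝ) :
    ∫ θ in (0:ℝ)..(2 * π), f (θ + a) = ∫ θ in (0:ℝ)..(2 * π), f θ := by
  rw [intervalIntegral.integral_comp_add_right]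
  simpa [add_comm] using hf.intervalIntegral_add_eq a 0

lemma Function.Periodic.integral_zero_two_pi_comp_neg {f : ℝ → ℂ}
    (hf : Function.Periodic f (2 * π)) :
    ∫ θ in (0:ℝ)..(2 * π), f (-θ) = ∫ θ in (0:ℝ)..(2 * π), f θ := by
  rw [intervalIntegral.integral_comp_neg]
  simpa using hf.intervalIntegral_add_eq (-(2 * π)) 0

/-- Parseval's identity for two continuous `2π`-periodic functions. -/
lemma hasSum_conj_fourier_mul_fourier {f g : ℝ → ℂ}
    (hf : Function.Periodic f (2 * π)) (hg : Function.Periodic g (2 * π))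
    (hfc : Continuous f) (hgc : Continuous g) :
    HasSum (fun m : ℤ =>
        conj ((1 / (2 * π)) * ∫ θ in (0:ℝ)..(2 * π), cexp (-(m * θ * I)) * f θ) *
          ((1 / (2 * π)) * ∫ θ in (0:ℝ)..(2 * π), cexp (-(m * θ * I)) * g θ))
      ((1 / (2 * π)) * ∫ θ in (0:ℝ)..(2 * π), g θ * conj (f θ)) := by
  have : Fact (0 < 2 * π) := ⟨Real.two_pi_pos⟩
  let F : C(AddCircle (2 * π), ℂ) := ⟨hf.lift, hfc.quotient_lift _⟩
  let G : C(AddCircle (2 * π), ℂ) := ⟨hg.lift, hgc.quotient_lift _⟩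
  have hcoeff (h : ℝ → ℂ) (H : AddCircle (2 * π) → ℂ) (hH : ∀ θ : ℝ, H θ = h θ) (m : ℤ) :
      fourierCoeff H m =
        (1 / (2 * π)) * ∫ θ in (0:ℝ)..(2 * π), cexp (-(m * θ * I)) * h θ := by
    rw [fourierCoeff_eq_intervalIntegral H m 0, zero_add, Complex.real_smul]
    congr 1
    · push_cast; rfl
    · refine intervalIntegral.integral_congr fun θ _ => ?_
      simp only [fourier_coe_apply, smul_eq_mul, hH]
      congr 2
      have : (π : ℂ) ≠ 0 := by exact_mod_cast Real.pi_ne_zero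
      push_cast
      field_simp
  have key := fourierBasis.hasSum_inner_mul_inner
    (ContinuousMap.toLp (E := ℂ) 2 AddCircle.haarAddCircle ℂ F)
    (ContinuousMap.toLp (E := ℂ) 2 AddCircle.haarAddCircle ℂ G)
  have hinner := hcoeff (fun θ => g θ * conj (f θ)) (fun t => G t * conj (F t)) (fun _ => rfl) 0
  simp only [fourierCoeff, neg_zero, fourier_zero, one_smul, Int.cast_zero, zero_mul,
    Complex.exp_zero, one_mul] at hinner
  rw [MeasureTheory.ContinuousMap.inner_toLp, hinner] at key
  convert! key using 2 with m
  rw [← inner_conj_symm, ← fourierBasis.repr_apply_apply, ← fourierBasis.repr_apply_apply,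
    fourierBasis_repr, fourierBasis_repr, fourierCoeff_toLp, fourierCoeff_toLp,
    hcoeff f F (fun _ => rfl), hcoeff g G (fun _ => rfl)]

lemma periodic_exp_sin_mul_exp (z : ℂ) (m : ℤ) :
    Function.Periodic (fun θ : ℝ => cexp (z * Complex.sin θ * I - m * θ * I)) (2 * π) := by
  intro θ
  simp only [ofReal_add, ofReal_mul, ofReal_ofNat, Complex.sin_add_two_pi]
  rw [show z * Complex.sin θ * I - m * (θ + 2 * π) * I =
    (z * Complex.sin θ * I - m * θ * I) - m * (2 * π * I) by ring]
  exact Complex.exp_periodic.sub_int_mul_eq m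

lemma periodic_exp_sin (z : ℂ) :
    Function.Periodic (fun θ : ℝ => cexp (z * Complex.sin θ * I)) (2 * π) := by
  simpa using periodic_exp_sin_mul_exp z 0

lemma conj_besselJ_ofReal (m : ℤ) (x : ℝ) : conj (besselJ m x) = besselJ m x := by
  unfold besselJ
  rw [map_mul, ← intervalIntegral.intervalIntegral_conj]
  conv_rhs => rw [← (periodic_exp_sin_mul_exp x m).integral_zero_two_pi_comp_neg]
  congr 1
  · simp [Complex.conj_ofNat]
  · refine intervalIntegral.integral_congr fun θ _ => ?_
    simp only [← Complex.exp_conj]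
    congr 1
    simp [← Complex.sin_conj]

lemma besselJ_eq_integral_mul (m : ℤ) (z : ℂ) :
    besselJ m z = (1 / (2 * π)) *
      ∫ θ in (0:ℝ)..(2 * π), cexp (-(m * θ * I)) * cexp (z * Complex.sin θ * I) := by
  simp only [besselJ, ← Complex.exp_add]
  congr! 4
  ring

lemma besselJ_zero_zero : besselJ 0 0 = 1 := by
  have : (π : ℂ) ≠ 0 := by exact_mod_cast Real.pi_ne_zero
  simp [besselJ]
  field_simp

/-- A special case of Graf's addition theorem. -/
lemma hasSum_besselJ_sq_mul_exp (x a : ℝ) :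
    HasSum (fun m : ℤ => besselJ m x ^ 2 * cexp (m * a * I))
      (besselJ 0 ((2 * x * Real.sin (a / 2) : ℝ) : ℂ)) := by
  have hper := periodic_exp_sin x
  have key := hasSum_conj_fourier_mul_fourier hper
    (g := fun θ : ℝ => cexp (x * Complex.sin ((θ + a : ℝ) : ℂ) * I))
    (fun θ => by
      have := hper (θ + a)
      simp only at this ⊢
      rw [← this, show θ + 2 * π + a = θ + a + 2 * π by ring])
    (by fun_prop) (by fun_prop)
  convert! key using 1
  · ext m
    rw [← besselJ_eq_integral_mul, conj_besselJ_ofReal, sq, mul_assoc]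
    congr 1
    have hshift := (periodic_exp_sin_mul_exp x m).integral_zero_two_pi_comp_add a
    rw [besselJ, ← hshift, mul_assoc, ← intervalIntegral.integral_mul_const]
    congr 1
    refine intervalIntegral.integral_congr fun θ _ => ?_
    simp only [← Complex.exp_add]
    congr 1
    push_cast
    ring
  · rw [besselJ, ← (periodic_exp_sin_mul_exp _ 0).integral_zero_two_pi_comp_add (a / 2 + π / 2)]
    congr 1
    refine intervalIntegral.integral_congr fun θ _ => ?_
    simp only [← Complex.exp_conj, ← Complex.exp_add]
    congr 1
    have h : 2 * Real.sin (a / 2) * Real.sin (θ + (a / 2 + π / 2)) =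
        Real.sin (θ + a) - Real.sin θ := by
      rw [Real.sin_sub_sin, ← add_assoc, Real.sin_add_pi_div_two]
      ring_nf
    have h' := congrArg (fun r : ℝ => (r : ℂ)) h
    simp only [map_mul, conj_I, conj_ofReal, ← Complex.sin_conj]
    push_cast at h' ⊢
    linear_combination x * I * h'

/-- Orthogonality of the additive characters of `ℤ / n`. -/
lemma sum_exp_two_pi_mul_div (n : ℕ) (hn : n ≠ 0) (q : ℤ) :
    ∑ j ∈ Finset.range n, cexp (q * (2 * π * j / n : ℝ) * I) =
      if (n : ℤ) ∣ q then (n : ℂ) else 0 := by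
  have hζ := Complex.isPrimitiveRoot_exp n hn
  set ζ := cexp (2 * π * I / n) with hζdef
  have hterm (j : ℕ) : cexp (q * (2 * π * j / n : ℝ) * I) = (ζ ^ q) ^ j := by
    rw [hζdef, ← Complex.exp_int_mul, ← Complex.exp_nat_mul]
    congr 1
    push_cast
    ring
  simp only [hterm]
  split_ifs with h
  · simp [(hζ.zpow_eq_one_iff_dvd q).2 h]
  · have h1 : ζ ^ q ≠ 1 := fun H => h ((hζ.zpow_eq_one_iff_dvd q).1 H)
    rw [geom_sum_eq h1, ← zpow_natCast, ← zpow_mul, mul_comm, zpow_mul, zpow_natCast,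
      hζ.pow_eq_one]
    simp

lemma hasSum_besselJ_sq_residue_class (n : ℕ) (hn : n ≠ 0) (p : ℤ) (x : ℝ) :
    HasSum (fun k : ℤ => besselJ (k * n + p) x ^ 2)
      ((1 / n) * ∑ j ∈ Finset.range n, cexp (-(p * (2 * π * j / n : ℝ) * I)) *
        besselJ 0 ((2 * x * Real.sin (π * j / n) : ℝ) : ℂ)) := by
  have hnC : (n : ℂ) ≠ 0 := by exact_mod_cast hn
  have hall : HasSum (fun m : ℤ => if (n : ℤ) ∣ m - p then besselJ m x ^ 2 else 0)
      ((1 / n) * ∑ j ∈ Finset.range n, cexp (-(p * (2 * π * j / n : ℝ) * I)) *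
        besselJ 0 ((2 * x * Real.sin (π * j / n) : ℝ) : ℂ)) := by
    have h := (hasSum_sum fun j (_ : j ∈ Finset.range n) =>
      (hasSum_besselJ_sq_mul_exp x (2 * π * j / n)).mul_left
        (cexp (-(p * (2 * π * j / n : ℝ) * I)))).mul_left (1 / (n : ℂ))
    convert! h using 1
    · ext m
      have hsum := sum_exp_two_pi_mul_div n hn (m - p)
      have hterm : ∑ j ∈ Finset.range n, cexp (-(p * (2 * π * j / n : ℝ) * I)) *
          (besselJ m x ^ 2 * cexp (m * (2 * π * j / n : ℝ) * I)) =
          besselJ m x ^ 2 * ∑ j ∈ Finset.range n,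
            cexp ((m - p : ℤ) * (2 * π * j / n : ℝ) * I) := by
        rw [Finset.mul_sum]
        refine Finset.sum_congr rfl fun j _ => ?_
        rw [mul_left_comm, ← Complex.exp_add]
        congr 2
        push_cast
        ring
      rw [hterm, hsum]
      split_ifs
      · field_simp
      · simp
    · congr! 7 with j
      ring
  have hinj : Function.Injective fun k : ℤ => k * (n : ℤ) + p := fun a b hab => by
    simpa [hn] using hab
  rw [← hinj.hasSum_iff] at hall
  · simpa [Function.comp_def] using hall
  · intro m hm
    refine if_neg fun ⟨k, hk⟩ => hm ⟨k, ?_⟩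
    simp only
    linarith [mul_comm k (n : ℤ)]

theorem statement13 (n : ℤ) (hn : 1 ≤ n) (p : ℤ) (x : ℝ) :
    (∑' k : ℤ, besselJ (k * n + p) x ^ 2) =
      1 / (n:ℂ) + (1 / (n:ℂ)) * ∑ k ∈ Finset.Ico 1 n.toNat,
        (Real.cos (2 * π * k * p / n) : ℂ) * besselJ 0 ((2 * x * Real.sin (π * k / n) : ℝ) : ℂ) := by
  lift n to ℕ using by omega
  have hn0 : n ≠ 0 := by omega
  have hsum := hasSum_besselJ_sq_residue_class n hn0 p x
  have hconj := hsum.star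
  simp only [star_pow, RCLike.star_def, conj_besselJ_ofReal] at hconj
  have havg : ∑' k : ℤ, besselJ (k * n + p) x ^ 2 = (1 / n) * ∑ j ∈ Finset.range n,
      (Real.cos (2 * π * j * p / n) : ℂ) *
        besselJ 0 ((2 * x * Real.sin (π * j / n) : ℝ) : ℂ) := by
    have htwice := hsum.tsum_eq
    have htwice' := hconj.tsum_eq
    rw [map_mul, map_sum] at htwice'
    simp only [map_mul, conj_besselJ_ofReal, ← Complex.exp_conj] at htwice'
    have hadd : 2 * ∑' k : ℤ, besselJ (k * n + p) x ^ 2 =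
        2 * ((1 / n) * ∑ j ∈ Finset.range n, (Real.cos (2 * π * j * p / n) : ℂ) *
          besselJ 0 ((2 * x * Real.sin (π * j / n) : ℝ) : ℂ)) := by
      rw [two_mul]
      nth_rw 1 [htwice]
      rw [htwice']
      simp only [map_div₀, map_one, map_natCast]
      rw [← mul_add, ← Finset.sum_add_distrib, mul_left_comm,
        Finset.mul_sum _ _ (2 : ℂ)]
      congr 1
      refine Finset.sum_congr rfl fun j _ => ?_
      rw [← add_mul, ← mul_assoc]
      congr 1
      rw [Complex.ofReal_cos, Complex.two_cos, add_comm]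
      congr 2
      · simp only [map_neg, map_mul, conj_ofReal, conj_I, map_intCast]
        push_cast
        ring
      · push_cast
        ring
    exact mul_left_cancel₀ two_ne_zero hadd
  rw [Int.cast_natCast, Int.toNat_natCast, havg, Finset.range_eq_Ico,
    Finset.sum_eq_sum_Ico_succ_bot (by omega), mul_add]
  simp [besselJ_zero_zero]
end
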